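/- arXiv:0810.1794 — 4 statements merged into one kernel-verified Lean document; each statement's English description precedes it below -/
import Mathlib

section
/- For every natural number n ≥ 1 and every convex body K ⊆ ℝⁿ (a nonempty compact convex set), there exists a real polynomial P of degree at most n whose coefficient in degree n equals the volume of the unit ball of ℝⁿ, such that for all real t ≥ 0, the Lebesgue volume of the Minkowski sum K + tB equals P(t). (Steiner's formula: the volume of the outer parallel body is a polynomial in t.) -/
open MeasureTheory Metric Pointwise

open Set Filter Topology Module
open scoped RealInnerProductSpace NNReal

section FirmlyNonexpansive

variable {E : Type*} [NormedAddCommGroup E] [InnerProductSpace ℝ E]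

/-- A map `p` is firmly nonexpansive if `‖p x - p y‖² ≤ ⟪p x - p y, x - y⟫` for all `x`, `y`. -/
def FirmlyNonexpansive (p : E → E) : Prop :=
  ∀ x y, 0 ≤ ⟪p x - p y, (x - p x) - (y - p y)⟫

/-- The map moving each point `x` along the ray from `p x` through `x`, scaling the displacement
`x - p x` by the factor `s`. -/
def stretch (p : E → E) (s : ℝ) (x : E) : E := p x + s • (x - p x)

lemma eq_zero_of_add_smul_eq_zero {a b : E} (h : 0 ≤ ⟪a, b⟫) {s : ℝ} (hs : 0 < s)
    (hab : a + s • b = 0) : a = 0 ∧ b = 0 := by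
  obtain rfl : a = -(s • b) := eq_neg_of_add_eq_zero_left hab
  have hb : b = 0 := by
    rw [inner_neg_left, real_inner_smul_left, real_inner_self_eq_norm_sq] at h
    have : ‖b‖ ^ 2 = 0 := by nlinarith [sq_nonneg ‖b‖]
    simpa using this
  simp [hb]

namespace FirmlyNonexpansive

variable {p : E → E}

lemma lipschitzWith (hp : FirmlyNonexpansive p) : LipschitzWith 1 p := by
  refine LipschitzWith.of_dist_le_mul fun x y ↦ ?_
  have h := hp x y
  have hxy : x - y = (p x - p y) + ((x - p x) - (y - p y)) := by abel
  rw [NNReal.coe_one, one_mul, dist_eq_norm, dist_eq_norm, hxy]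
  refine le_of_sq_le_sq ?_ (norm_nonneg _)
  rw [norm_add_sq_real]
  nlinarith [sq_nonneg ‖(x - p x) - (y - p y)‖]

lemma stretch_injective (hp : FirmlyNonexpansive p) {s : ℝ} (hs : 0 < s) :
    Function.Injective (stretch p s) := by
  intro x y hxy
  have h0 : (p x - p y) + s • ((x - p x) - (y - p y)) = 0 := by
    rw [← sub_eq_zero.2 hxy, stretch, stretch]
    module
  obtain ⟨h1, h2⟩ := eq_zero_of_add_smul_eq_zero (hp x y) hs h0
  rwa [sub_sub_sub_comm, h1, sub_zero, sub_eq_zero] at h2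

lemma exists_lipschitzWith_stretch (hp : FirmlyNonexpansive p) (s : ℝ) :
    ∃ C : ℝ≥0, LipschitzWith C (stretch p s) :=
  ⟨_, hp.lipschitzWith.add
    ((lipschitzWith_smul s).comp (LipschitzWith.id.sub hp.lipschitzWith))⟩

lemma inner_fderiv_nonneg (hp : FirmlyNonexpansive p) {x : E} {A : E →L[ℝ] E}
    (hA : HasFDerivAt p A x) (v : E) : 0 ≤ ⟪A v, v - A v⟫ := by
  have h := (hA.hasLineDerivAt v).tendsto_slope_zero
  refine ge_of_tendsto (h.inner (tendsto_const_nhds.sub h)) ?_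
  filter_upwards [self_mem_nhdsWithin] with t ht
  have ht : t ≠ 0 := ht
  have hv : v - t⁻¹ • (p (x + t • v) - p x)
      = t⁻¹ • ((x + t • v - p (x + t • v)) - (x - p x)) := by
    have : v = t⁻¹ • (t • v) := by rw [inv_smul_smul₀ ht]
    nth_rw 1 [this]
    module
  rw [hv, real_inner_smul_left, real_inner_smul_right, ← mul_assoc]
  exact mul_nonneg (mul_self_nonneg _) (hp _ _)

end FirmlyNonexpansive

lemma hasFDerivAt_stretch {p : E → E} {x : E} {A : E →L[ℝ] E} (hA : HasFDerivAt p A x) (s : ℝ) :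
    HasFDerivAt (stretch p s) (A + s • (ContinuousLinearMap.id ℝ E - A)) x :=
  hA.add (((hasFDerivAt_id x).sub hA).const_smul s)

variable [FiniteDimensional ℝ E]

lemma det_add_smul_id_sub_pos {A : E →L[ℝ] E} (hA : ∀ v, 0 ≤ ⟪A v, v - A v⟫) {s : ℝ}
    (hs : 0 < s) : 0 < (A + s • (ContinuousLinearMap.id ℝ E - A)).det := by
  set f : ℝ → ℝ := fun s ↦ (A + s • (ContinuousLinearMap.id ℝ E - A)).det with hf
  have hne : ∀ r, 0 < r → f r ≠ 0 := by
    intro r hr h0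
    obtain ⟨v, hv, hv0⟩ := Submodule.exists_mem_ne_zero_of_ne_bot
      (LinearMap.bot_lt_ker_of_det_eq_zero h0).ne'
    obtain ⟨h1, h2⟩ := eq_zero_of_add_smul_eq_zero (hA v) hr (by simpa using hv)
    apply hv0
    simpa [h1] using h2
  have hcont : Continuous f := ContinuousLinearMap.continuous_det.comp (by fun_prop)
  have h1 : f 1 = 1 := by
    have : A + (1 : ℝ) • (ContinuousLinearMap.id ℝ E - A) = ContinuousLinearMap.id ℝ E := by
      simp
    simp only [hf, this]
    exact LinearMap.det_id
  by_contra! hle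
  obtain ⟨r, hr, hr0⟩ := isPreconnected_Ioi.intermediate_value (a := s) (b := 1) (mem_Ioi.2 hs)
    (mem_Ioi.2 one_pos) hcont.continuousOn ⟨hle, h1.symm ▸ zero_le_one⟩
  exact hne r hr hr0

lemma exists_polynomial_eval_eq_det_add_smul (A B : E →L[ℝ] E) :
    ∃ q : Polynomial ℝ, q.natDegree ≤ finrank ℝ E ∧ ∀ s : ℝ, (A + s • B).det = q.eval s := by
  let b := finBasis ℝ E
  let M := LinearMap.toMatrix b b
  refine ⟨_, (Polynomial.natDegree_det_X_add_C_le (M B) (M A)).trans (by simp), fun s ↦ ?_⟩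
  rw [ContinuousLinearMap.det, ← LinearMap.det_toMatrix b, ← Polynomial.coe_evalRingHom,
    RingHom.map_det]
  congr 1
  ext i j
  simp [M, mul_comm s, add_comm (_ * s)]

end FirmlyNonexpansive

section Interpolation

/-- If every `f x` with `x ∈ D` is a polynomial of degree at most `n` in a positive parameter and
is integrable for each value of the parameter, then so is its integral over `D`. -/
lemma exists_polynomial_eval_eq_setIntegral {α : Type*} [MeasurableSpace α] {μ : Measure α}
    {D : Set α} (hD : MeasurableSet D) {f : α → ℝ → ℝ} {n : ℕ}
    (hf : ∀ x ∈ D, ∃ q : Polynomial ℝ, q.natDegree ≤ n ∧ ∀ s, 0 < s → f x s = q.eval s)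
    (hint : ∀ s, 0 < s → IntegrableOn (fun x ↦ f x s) D μ) :
    ∃ P : Polynomial ℝ, P.natDegree ≤ n ∧ ∀ s, 0 < s → ∫ x in D, f x s ∂μ = P.eval s := by
  let v : ℕ → ℝ := fun i ↦ i + 1
  have hvpos : ∀ i, 0 < v i := fun i ↦ by positivity
  have hv : Set.InjOn v (Finset.range (n + 1)) := fun i _ j _ h ↦ by simpa [v] using h
  let L := Lagrange.basis (Finset.range (n + 1)) v
  have hL : ∀ i ∈ Finset.range (n + 1), (L i).natDegree ≤ n := fun i hi ↦ by
    simp [L, Lagrange.natDegree_basis hv hi]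
  refine ⟨∑ i ∈ Finset.range (n + 1), Polynomial.C (∫ x in D, f x (v i) ∂μ) * L i,
    Polynomial.natDegree_sum_le_of_forall_le _ _ fun i hi ↦
      (Polynomial.natDegree_C_mul_le _ _).trans (hL i hi), fun s hs ↦ ?_⟩
  have key : ∀ x ∈ D, f x s = ∑ i ∈ Finset.range (n + 1), f x (v i) * (L i).eval s := by
    intro x hx
    obtain ⟨q, hq, hqf⟩ := hf x hx
    have hdeg : q.degree < (Finset.range (n + 1)).card := by
      rw [Finset.card_range]
      exact (Polynomial.degree_le_of_natDegree_le hq).trans_lt (by exact_mod_cast n.lt_succ_self)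
    rw [hqf s hs, Lagrange.eq_interpolate hv hdeg, Lagrange.interpolate_apply,
      Polynomial.eval_finsetSum]
    refine Finset.sum_congr rfl fun i _ ↦ ?_
    rw [Polynomial.eval_mul, Polynomial.eval_C, hqf _ (hvpos i)]
  rw [setIntegral_congr_fun hD key, integral_finsetSum _ fun i _ ↦ (hint _ (hvpos i)).mul_const _,
    Polynomial.eval_finsetSum]
  simp [integral_mul_const]

/-- A polynomial of degree at most `n` squeezed between `c * t ^ n` and `c * (t + R) ^ n` has
`n`-th coefficient `c`. -/
lemma coeff_eq_of_mul_pow_le_eval {P : Polynomial ℝ} {n : ℕ} (hP : P.natDegree ≤ n) {c R : ℝ}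
    (hlow : ∀ t, 0 < t → c * t ^ n ≤ P.eval t)
    (hupp : ∀ t, 0 < t → P.eval t ≤ c * (t + R) ^ n) : P.coeff n = c := by
  let Q := P.reflect n
  have hQ : ∀ s, 0 < s → Q.eval s = P.eval s⁻¹ * s ^ n := by
    intro s hs
    let : Invertible s⁻¹ := invertibleOfNonzero (inv_pos.2 hs).ne'
    have h := Polynomial.eval₂_reflect_mul_pow (RingHom.id ℝ) s⁻¹ n P hP
    rw [invOf_eq_inv, inv_inv] at h
    rw [Polynomial.eval, Polynomial.eval, ← h, mul_assoc, ← mul_pow, inv_mul_cancel₀ hs.ne',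
      one_pow, mul_one]
  have h0 : Q.eval 0 = P.coeff n := by
    rw [← Polynomial.coeff_zero_eq_eval_zero, Polynomial.coeff_reflect]
    simp
  have hlim : Tendsto (fun s ↦ Q.eval s) (𝓝[>] 0) (𝓝 (P.coeff n)) := by
    rw [← h0]
    exact Q.continuous.continuousAt.tendsto.mono_left nhdsWithin_le_nhds
  refine tendsto_nhds_unique hlim (tendsto_of_tendsto_of_tendsto_of_le_of_le' tendsto_const_nhds
    (h := fun s ↦ c * (1 + R * s) ^ n) ?_ ?_ ?_)
  · have : Tendsto (fun s : ℝ ↦ c * (1 + R * s) ^ n) (𝓝 0) (𝓝 (c * (1 + R * 0) ^ n)) :=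
      Continuous.tendsto (by fun_prop) 0
    simpa using this.mono_left nhdsWithin_le_nhds
  · filter_upwards [self_mem_nhdsWithin] with s hs
    have hs : 0 < s := hs
    calc c = c * s⁻¹ ^ n * s ^ n := by rw [mul_assoc, ← mul_pow, inv_mul_cancel₀ hs.ne']; simp
      _ ≤ P.eval s⁻¹ * s ^ n := by gcongr; exact hlow _ (inv_pos.2 hs)
      _ = Q.eval s := (hQ s hs).symm
  · filter_upwards [self_mem_nhdsWithin] with s hs
    have hs : 0 < s := hs
    calc Q.eval s = P.eval s⁻¹ * s ^ n := hQ s hs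
      _ ≤ c * (s⁻¹ + R) ^ n * s ^ n := by gcongr; exact hupp _ (inv_pos.2 hs)
      _ = c * (1 + R * s) ^ n := by
        rw [mul_assoc, ← mul_pow, add_mul, inv_mul_cancel₀ hs.ne']

end Interpolation

section ParallelBody

variable {E : Type*} [NormedAddCommGroup E] [InnerProductSpace ℝ E]

lemma firmlyNonexpansive_of_inner_le_zero {K : Set E} {p : E → E} (hpK : ∀ x, p x ∈ K)
    (hp : ∀ x, ∀ w ∈ K, ⟪x - p x, w - p x⟫ ≤ 0) : FirmlyNonexpansive p := by
  intro x y
  have h1 := hp x (p y) (hpK y)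
  have h2 := hp y (p x) (hpK x)
  rw [← neg_sub (p x) (p y), inner_neg_right] at h1
  rw [inner_sub_right, real_inner_comm, real_inner_comm (y - p y)]
  linarith

lemma eq_of_inner_le_zero {K : Set E} {p : E → E} (hpK : ∀ x, p x ∈ K)
    (hp : ∀ x, ∀ w ∈ K, ⟪x - p x, w - p x⟫ ≤ 0) {x z : E} (hz : z ∈ K)
    (hxz : ∀ w ∈ K, ⟪x - z, w - z⟫ ≤ 0) : p x = z := by
  have h1 := hp x z hz
  have h2 := hxz (p x) (hpK x)
  have h3 : ⟪p x - z, p x - z⟫ = ⟪x - z, p x - z⟫ + ⟪x - p x, z - p x⟫ := by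
    rw [← neg_sub (p x) z, inner_neg_right, ← sub_eq_add_neg, ← inner_sub_left]
    congr 1
    abel
  rw [← sub_eq_zero, ← inner_self_eq_zero (𝕜 := ℝ)]
  exact le_antisymm (h3 ▸ add_nonpos h2 h1) real_inner_self_nonneg

/-- Points of a convex set realizing the distance to it. -/
lemma exists_nearestPoint {K : Set E} (hne : K.Nonempty) (hK : IsCompact K)
    (hconv : Convex ℝ K) :
    ∃ p : E → E, (∀ x, p x ∈ K) ∧ (∀ x, ∀ w ∈ K, ⟪x - p x, w - p x⟫ ≤ 0) := by
  choose p hpK hp using exists_norm_eq_iInf_of_complete_convex hne hK.isComplete hconv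
  exact ⟨p, hpK, fun x ↦ (norm_eq_iInf_iff_real_inner_le_zero hconv (hpK x)).1 (hp x)⟩

lemma norm_sub_le_of_inner_le_zero {x y w : E} (h : ⟪x - y, w - y⟫ ≤ 0) : ‖x - y‖ ≤ ‖x - w‖ := by
  have hxw : x - w = (x - y) - (w - y) := by abel
  refine le_of_sq_le_sq ?_ (norm_nonneg _)
  rw [hxw, norm_sub_sq_real (x - y)]
  nlinarith [sq_nonneg ‖w - y‖]

lemma mem_cthickening_iff_norm_sub_le {K : Set E} (hK : IsCompact K) {p : E → E}
    (hpK : ∀ x, p x ∈ K) (hp : ∀ x, ∀ w ∈ K, ⟪x - p x, w - p x⟫ ≤ 0) {s : ℝ} (hs : 0 ≤ s)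
    (x : E) : x ∈ cthickening s K ↔ ‖x - p x‖ ≤ s := by
  rw [hK.cthickening_eq_biUnion_closedBall hs]
  simp only [mem_iUnion, mem_closedBall, dist_eq_norm, exists_prop]
  exact ⟨fun ⟨w, hw, hxw⟩ ↦ (norm_sub_le_of_inner_le_zero (hp x w hw)).trans hxw,
    fun h ↦ ⟨p x, hpK x, h⟩⟩

lemma stretch_image_cthickening {K : Set E} (hK : IsCompact K) {p : E → E}
    (hpK : ∀ x, p x ∈ K) (hp : ∀ x, ∀ w ∈ K, ⟪x - p x, w - p x⟫ ≤ 0) {s : ℝ} (hs : 0 < s) :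
    stretch p s '' cthickening 1 K = cthickening s K := by
  have hmem := fun r (hr : 0 ≤ r) ↦ mem_cthickening_iff_norm_sub_le hK hpK hp (s := r) hr
  have hproj : ∀ r : ℝ, 0 ≤ r → ∀ x, p (p x + r • (x - p x)) = p x := fun r hr x ↦
    eq_of_inner_le_zero hpK hp (hpK x) fun w hw ↦ by
      rw [add_sub_cancel_left, real_inner_smul_left]
      exact mul_nonpos_of_nonneg_of_nonpos hr (hp x w hw)
  ext y
  constructor
  · rintro ⟨x, hx, rfl⟩
    rw [hmem 1 zero_le_one] at hx
    rw [hmem s hs.le, stretch, hproj s hs.le, add_sub_cancel_left, norm_smul,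
      Real.norm_of_nonneg hs.le]
    exact mul_le_of_le_one_right hs.le hx
  · intro hy
    rw [hmem s hs.le] at hy
    have hs' : 0 ≤ s⁻¹ := (inv_pos.2 hs).le
    refine ⟨p y + s⁻¹ • (y - p y), ?_, ?_⟩
    · rw [hmem 1 zero_le_one, hproj _ hs', add_sub_cancel_left, norm_smul,
        Real.norm_of_nonneg hs', inv_mul_le_iff₀ hs, mul_one]
      exact hy
    · rw [stretch, hproj _ hs', add_sub_cancel_left, smul_inv_smul₀ hs.ne', add_sub_cancel]

variable [FiniteDimensional ℝ E] [MeasurableSpace E] [BorelSpace E]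

lemma LipschitzWith.addHaar_image_eq_zero (μ : Measure E) [μ.IsAddHaarMeasure] {f : E → E}
    {C : ℝ≥0} (hf : LipschitzWith C f) {s : Set E} (hs : μ s = 0) : μ (f '' s) = 0 := by
  have h1 : μH[finrank ℝ E] s = 0 := by
    rw [Measure.isAddLeftInvariant_eq_smul μH[finrank ℝ E] μ, Measure.smul_apply, hs, smul_zero]
  have h2 : μH[finrank ℝ E] (f '' s) = 0 := by
    have := hf.hausdorffMeasure_image_le (Nat.cast_nonneg (finrank ℝ E)) s
    simpa [h1] using this
  rw [Measure.isAddLeftInvariant_eq_smul μ μH[finrank ℝ E], Measure.smul_apply, h2, smul_zero]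

/-- The volume of the closed thickenings of a convex body is polynomial for positive radii. -/
lemma exists_polynomial_eval_eq_measureReal_cthickening_of_pos (μ : Measure E)
    [μ.IsAddHaarMeasure] {K : Set E} (hne : K.Nonempty) (hK : IsCompact K)
    (hconv : Convex ℝ K) :
    ∃ P : Polynomial ℝ, P.natDegree ≤ finrank ℝ E ∧
      ∀ s, 0 < s → μ.real (cthickening s K) = P.eval s := by
  obtain ⟨p, hpK, hp⟩ := exists_nearestPoint hne hK hconv
  have hfirm : FirmlyNonexpansive p := firmlyNonexpansive_of_inner_le_zero hpK hp
  set S : Set E := {x | DifferentiableAt ℝ p x}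
  set D : Set E := cthickening 1 K ∩ S
  have hD : MeasurableSet D :=
    isClosed_cthickening.measurableSet.inter (measurableSet_of_differentiableAt ℝ p)
  let F : ℝ → E → E →L[ℝ] E :=
    fun s x ↦ fderiv ℝ p x + s • (ContinuousLinearMap.id ℝ E - fderiv ℝ p x)
  have hderiv : ∀ s, ∀ x ∈ D, HasFDerivWithinAt (stretch p s) (F s x) D x := fun s x hx ↦
    (hasFDerivAt_stretch hx.2.hasFDerivAt s).hasFDerivWithinAt
  have hinj : ∀ s, 0 < s → InjOn (stretch p s) D := fun s hs ↦
    (hfirm.stretch_injective hs).injOn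
  have himage : ∀ s, 0 < s → μ (stretch p s '' D) = μ (cthickening s K) := by
    intro s hs
    obtain ⟨C, hC⟩ := hfirm.exists_lipschitzWith_stretch s
    have hnull : μ (stretch p s '' Sᶜ) = 0 :=
      hC.addHaar_image_eq_zero μ (ae_iff.1 hfirm.lipschitzWith.ae_differentiableAt)
    rw [← stretch_image_cthickening hK hpK hp hs]
    refine le_antisymm (measure_mono (image_mono inter_subset_left)) ?_
    calc μ (stretch p s '' cthickening 1 K)
        ≤ μ (stretch p s '' D ∪ stretch p s '' Sᶜ) := by
          rw [← image_union]
          refine measure_mono (image_mono fun x hx ↦ ?_)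
          by_cases hxS : x ∈ S
          · exact Or.inl ⟨hx, hxS⟩
          · exact Or.inr hxS
      _ ≤ μ (stretch p s '' D) := (measure_union_le _ _).trans (by rw [hnull, add_zero])
  have hfin : ∀ s, μ (cthickening s K) ≠ ⊤ := fun s ↦ hK.isBounded.cthickening.measure_lt_top.ne
  have hpoly : ∀ x ∈ D, ∃ q : Polynomial ℝ, q.natDegree ≤ finrank ℝ E ∧
      ∀ s, 0 < s → |(F s x).det| = q.eval s := by
    intro x hx
    obtain ⟨q, hq, hqdet⟩ := exists_polynomial_eval_eq_det_add_smul (fderiv ℝ p x)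
      (ContinuousLinearMap.id ℝ E - fderiv ℝ p x)
    refine ⟨q, hq, fun s hs ↦ ?_⟩
    rw [← hqdet s]
    exact abs_of_pos
      (det_add_smul_id_sub_pos (hfirm.inner_fderiv_nonneg hx.2.hasFDerivAt) hs)
  have hint : ∀ s, 0 < s → IntegrableOn (fun x ↦ |(F s x).det|) D μ := by
    intro s hs
    have h := integrableOn_image_iff_integrableOn_abs_det_fderiv_smul μ hD (hderiv s) (hinj s hs)
      (fun _ ↦ (1 : ℝ))
    simp only [smul_eq_mul, mul_one] at h
    refine h.1 (integrableOn_const ?_)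
    rw [himage s hs]
    exact hfin s
  obtain ⟨P, hP, hPeval⟩ := exists_polynomial_eval_eq_setIntegral hD hpoly hint
  refine ⟨P, hP, fun s hs ↦ ?_⟩
  have h := integral_image_eq_integral_abs_det_fderiv_smul μ hD (hderiv s) (hinj s hs)
    (fun _ ↦ (1 : ℝ))
  rw [← hPeval s hs]
  simpa [measureReal_def, himage s hs] using h

/-- **Steiner's formula** for closed thickenings with respect to any additive Haar measure. -/
theorem exists_polynomial_eval_eq_measureReal_cthickening (μ : Measure E) [μ.IsAddHaarMeasure]
    {K : Set E} (hne : K.Nonempty) (hK : IsCompact K) (hconv : Convex ℝ K) :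
    ∃ P : Polynomial ℝ, P.natDegree ≤ finrank ℝ E ∧
      P.coeff (finrank ℝ E) = μ.real (closedBall 0 1) ∧
      ∀ t, 0 ≤ t → μ.real (cthickening t K) = P.eval t := by
  obtain ⟨P, hP, hPeval⟩ := exists_polynomial_eval_eq_measureReal_cthickening_of_pos μ hne hK hconv
  have hfin : ∀ s, μ (cthickening s K) ≠ ⊤ := fun s ↦ hK.isBounded.cthickening.measure_lt_top.ne
  have hball : ∀ (x : E) (r : ℝ), 0 ≤ r →
      μ.real (closedBall x r) = μ.real (closedBall 0 1) * r ^ finrank ℝ E := by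
    intro x r hr
    rw [measureReal_def, measureReal_def, Measure.addHaar_closedBall μ x hr,
      Measure.addHaar_closedBall μ 0 zero_le_one]
    simp [ENNReal.toReal_ofReal (pow_nonneg hr _), mul_comm]
  refine ⟨P, hP, ?_, fun t ht ↦ ?_⟩
  · obtain ⟨x, hx⟩ := hne
    obtain ⟨R, hR, hKR⟩ := hK.isBounded.subset_closedBall_lt 0 0
    refine coeff_eq_of_mul_pow_le_eval hP (R := R) (fun t ht ↦ ?_) fun t ht ↦ ?_
    · rw [← hPeval t ht, ← hball x t ht.le]
      exact measureReal_mono (closedBall_subset_cthickening hx t) (hfin t)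
    · rw [← hPeval t ht, ← hball 0 (t + R) (by positivity), ← cthickening_closedBall ht.le hR.le]
      refine measureReal_mono (cthickening_subset_of_subset t hKR) ?_
      exact isBounded_closedBall.cthickening.measure_lt_top.ne
  · obtain rfl | ht := ht.eq_or_lt
    · have h1 : Tendsto (fun r ↦ μ.real (cthickening r K)) (𝓝[>] 0)
          (𝓝 (μ.real (cthickening 0 K))) := by
        rw [cthickening_zero, hK.isClosed.closure_eq]
        exact ((ENNReal.tendsto_toReal hK.measure_lt_top.ne).comp
          (tendsto_measure_cthickening_of_isCompact hK)).mono_left nhdsWithin_le_nhds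
      refine tendsto_nhds_unique h1 ?_
      refine (P.continuous.continuousAt.tendsto.mono_left nhdsWithin_le_nhds).congr' ?_
      filter_upwards [self_mem_nhdsWithin] with s hs using (hPeval s hs).symm
    · exact hPeval t ht

end ParallelBody

/-- **Steiner's formula.** For every convex body `K ⊆ ℝⁿ` (n ≥ 1), the volume of the
outer parallel body `K + tB` is a polynomial in `t` of degree at most `n`, with leading
coefficient (in degree `n`) equal to the volume of the unit ball. -/
theorem steiner_polynomial_exists (n : ℕ) (hn : 1 ≤ n)
    (K : Set (EuclideanSpace ℝ (Fin n)))
    (hKne : K.Nonempty) (hKcomp : IsCompact K) (hKconv : Convex ℝ K) :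
    ∃ P : Polynomial ℝ, P.natDegree ≤ n ∧
      P.coeff n = (volume (closedBall (0 : EuclideanSpace ℝ (Fin n)) 1)).toReal ∧
      ∀ t : ℝ, 0 ≤ t →
        (volume (K + t • closedBall (0 : EuclideanSpace ℝ (Fin n)) 1)).toReal
          = P.eval t := by
  obtain ⟨P, hdeg, hcoeff, heval⟩ :=
    exists_polynomial_eval_eq_measureReal_cthickening volume hKne hKcomp hKconv
  rw [finrank_euclideanSpace_fin] at hdeg hcoeff
  refine ⟨P, hdeg, hcoeff, fun t ht ↦ ?_⟩
  rw [← heval t ht, measureReal_def, smul_unitClosedBall_of_nonneg ht,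
    hKcomp.add_closedBall ht, zero_vadd]
end

section
/- For every convex body K ⊆ ℝ² there exists a real number L ≥ 0 such that for all real t ≥ 0, the Lebesgue area of the Minkowski sum K + tB equals vol(K) + L·t + π·t². (The planar Steiner formula: S_K(t) = A_K + L_K t + π t², where L_K is the perimeter of K.) -/
open MeasureTheory Metric Pointwise

/-- Thickening a planar convex body along the second coordinate adds a multiple of the length of
its shadow on the first coordinate. -/
theorem volume_add_vertical_segment {K : Set (ℝ × ℝ)} (hK : IsCompact K) (hconv : Convex ℝ K)
    {t : ℝ} (ht : 0 ≤ t) :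
    volume (K + ({0} : Set ℝ) ×ˢ Set.Icc (-t) t)
      = volume K + ENNReal.ofReal (2 * t) * volume (Prod.fst '' K) := by
  have hproj : IsCompact (Prod.fst '' K) := hK.image continuous_fst
  have hsum : IsCompact (K + ({0} : Set ℝ) ×ˢ Set.Icc (-t) t) :=
    hK.add (isCompact_singleton.prod isCompact_Icc)
  have hslice (x : ℝ) : volume (Prod.mk x ⁻¹' (K + ({0} : Set ℝ) ×ˢ Set.Icc (-t) t))
      = volume (Prod.mk x ⁻¹' K)
        + (Prod.fst '' K).indicator (fun _ => ENNReal.ofReal (2 * t)) x := by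
    have hadd : Prod.mk x ⁻¹' (K + ({0} : Set ℝ) ×ˢ Set.Icc (-t) t)
        = Prod.mk x ⁻¹' K + Set.Icc (-t) t := by
      ext y
      simp only [Set.mem_preimage, Set.mem_add, Prod.exists, Set.mem_prod, Set.mem_singleton_iff,
        Prod.mk_add_mk, Prod.mk.injEq]
      constructor
      · rintro ⟨a, b, hab, c, d, ⟨rfl, hd⟩, rfl, rfl⟩
        exact ⟨b, by simpa using hab, d, hd, rfl⟩
      · rintro ⟨b, hb, d, hd, rfl⟩
        exact ⟨x, b, hb, 0, d, ⟨rfl, hd⟩, by simp, rfl⟩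
    rw [hadd]
    rcases (Prod.mk x ⁻¹' K).eq_empty_or_nonempty with he | hne
    · have hx : x ∉ Prod.fst '' K := by
        rintro ⟨⟨a, b⟩, hab, rfl⟩
        exact he.subset (show b ∈ Prod.mk a ⁻¹' K from hab)
      simp [he, hx]
    · have hx : x ∈ Prod.fst '' K := by
        obtain ⟨b, hb⟩ := hne
        exact ⟨(x, b), hb, rfl⟩
      have hc : IsCompact (Prod.mk x ⁻¹' K) := by
        have : Prod.mk x ⁻¹' K = Prod.snd '' (K ∩ Prod.fst ⁻¹' {x}) := by
          ext y
          simp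
        rw [this]
        exact (hK.inter_right (isClosed_singleton.preimage continuous_fst)).image continuous_snd
      have hv : Convex ℝ (Prod.mk x ⁻¹' K) := by
        intro a ha b hb p q hp hq hpq
        have := hconv ha hb hp hq hpq
        simpa [← add_mul, hpq] using this
      have hcon : IsConnected (Prod.mk x ⁻¹' K) := ⟨hne, hv.isPreconnected⟩
      have hle : sInf (Prod.mk x ⁻¹' K) ≤ sSup (Prod.mk x ⁻¹' K) :=
        Real.sInf_le_sSup _ hc.bddBelow hc.bddAbove
      rw [eq_Icc_of_connected_compact hcon hc, Set.Icc_add_Icc hle (by linarith),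
        Real.volume_Icc, Real.volume_Icc, Set.indicator_of_mem hx,
        ← ENNReal.ofReal_add (by linarith) (by linarith)]
      congr 1
      ring
  rw [Measure.volume_eq_prod, Measure.prod_apply hsum.measurableSet,
    Measure.prod_apply hK.measurableSet, lintegral_congr hslice,
    lintegral_add_left (measurable_measure_prodMk_left hK.measurableSet),
    lintegral_indicator_const hproj.measurableSet]

/-- Adding a multiple of a fixed segment to a planar convex body increases the area by an amount
which is a nonnegative, Minkowski-linear functional of the body. -/
theorem exists_volume_add_smul_segment (u : EuclideanSpace ℝ (Fin 2)) :
    ∃ W : Set (EuclideanSpace ℝ (Fin 2)) → ℝ,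
      (∀ K, IsCompact K → 0 ≤ W K) ∧
      (∀ K, IsCompact K → Convex ℝ K → K.Nonempty → ∀ t : ℝ, 0 ≤ t →
        volume.real (K + t • segment ℝ (-u) u) = volume.real K + t * W K) ∧
      (∀ K Z, IsCompact K → K.Nonempty → IsCompact Z → Z.Nonempty → ∀ t : ℝ, 0 ≤ t →
        W (K + t • Z) = W K + t * W Z) := by
  by_cases hu : u = 0
  · refine ⟨0, by simp, fun K _ _ _ t _ => ?_, by simp⟩
    simp [hu]
  obtain ⟨e, he⟩ : ∃ e : EuclideanSpace ℝ (Fin 2) ≃L[ℝ] ℝ × ℝ, e u = (0, 1) := by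
    let e₀ : EuclideanSpace ℝ (Fin 2) ≃L[ℝ] ℝ × ℝ := ContinuousLinearEquiv.ofFinrankEq (by simp)
    obtain ⟨A, hA⟩ := SeparatingDual.exists_continuousLinearEquiv_apply_eq (R := ℝ)
      (x := e₀ u) (y := ((0, 1) : ℝ × ℝ)) (by simpa using hu) (by simp)
    exact ⟨e₀.trans A, by simpa using hA⟩
  have hhaar := e.isAddHaarMeasure_map (volume : Measure (EuclideanSpace ℝ (Fin 2)))
  obtain ⟨c, hc⟩ : ∃ c : NNReal, ∀ S : Set (EuclideanSpace ℝ (Fin 2)),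
      volume.real S = c * volume.real (e '' S) := by
    refine ⟨(Measure.map e volume).addHaarScalarFactor volume, fun S => ?_⟩
    have h1 : volume S = Measure.map e volume (e '' S) := by
      have := e.toHomeomorph.measurableEmbedding.map_apply volume (e '' S)
      rw [show (⇑e.toHomeomorph) = e from rfl] at this
      rw [this, Set.preimage_image_eq _ e.injective]
    rw [Measure.isAddLeftInvariant_eq_smul (Measure.map e volume) volume] at h1
    rw [Measure.real, h1, Measure.smul_apply, ENNReal.smul_def, smul_eq_mul, ENNReal.toReal_mul,
      ENNReal.coe_toReal, Measure.real]
  let φ : EuclideanSpace ℝ (Fin 2) →L[ℝ] ℝ :=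
    (ContinuousLinearMap.fst ℝ ℝ ℝ).comp (e : EuclideanSpace ℝ (Fin 2) →L[ℝ] ℝ × ℝ)
  refine ⟨fun K => 2 * c * (sSup (φ '' K) - sInf (φ '' K)), ?_, ?_, ?_⟩
  · intro K hK
    have hc' := hK.image φ.continuous
    have := Real.sInf_le_sSup _ hc'.bddBelow hc'.bddAbove
    have := c.coe_nonneg
    exact mul_nonneg (by positivity) (by linarith)
  · intro K hK hconv hne t ht
    have hseg : e '' (t • segment ℝ (-u) u) = ({0} : Set ℝ) ×ˢ Set.Icc (-t) t := by
      ext ⟨x, y⟩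
      rw [Set.mem_prod, Set.mem_singleton_iff, Set.mem_Icc]
      constructor
      · rintro ⟨_, ⟨_, ⟨a, b, ha, hb, hab, rfl⟩, rfl⟩, h⟩
        simp only [map_smul, map_add, map_neg, he, Prod.neg_mk, Prod.smul_mk, Prod.mk_add_mk,
          smul_eq_mul, Prod.mk.injEq] at h
        obtain ⟨hx, rfl⟩ := h
        exact ⟨by simpa using hx.symm, by nlinarith, by nlinarith⟩
      · rintro ⟨rfl, hy1, hy2⟩
        obtain ⟨hle1, hle2⟩ : -1 ≤ y / t ∧ y / t ≤ 1 := by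
          rcases ht.eq_or_lt with rfl | hpos
          · simp
          · rw [le_div_iff₀ hpos, div_le_one hpos]
            exact ⟨by linarith, hy2⟩
        have hyt : t * (y / t) = y := by
          rcases ht.eq_or_lt with rfl | hpos
          · linarith
          · field_simp
        refine ⟨_, ⟨_, ⟨(1 - y / t) / 2, (1 + y / t) / 2, by linarith, by linarith, by ring, rfl⟩,
          rfl⟩, ?_⟩
        simp only [map_smul, map_add, map_neg, he, Prod.neg_mk, Prod.smul_mk, Prod.mk_add_mk,
          smul_eq_mul, Prod.mk.injEq]
        exact ⟨by simp, by linear_combination hyt⟩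
    have hφ : Prod.fst '' (e '' K) = φ '' K := by
      rw [Set.image_image]; rfl
    have hφc := hK.image φ.continuous
    have hcon : IsConnected (φ '' K) :=
      ⟨hne.image φ, (hconv.isPreconnected).image φ φ.continuous.continuousOn⟩
    have hle := Real.sInf_le_sSup _ hφc.bddBelow hφc.bddAbove
    have heK : IsCompact (e '' K) := hK.image e.continuous
    rw [hc, hc, Set.image_add, hseg, Measure.real,
      volume_add_vertical_segment heK
        (hconv.is_linear_image e.toLinearEquiv.toLinearMap.isLinear) ht, hφ,
      ENNReal.toReal_add heK.measure_lt_top.ne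
        (ENNReal.mul_ne_top ENNReal.ofReal_ne_top hφc.measure_lt_top.ne),
      ENNReal.toReal_mul, ENNReal.toReal_ofReal (by positivity), Measure.real]
    have hlen : (volume (φ '' K)).toReal = sSup (φ '' K) - sInf (φ '' K) := by
      conv_lhs => rw [eq_Icc_of_connected_compact hcon hφc]
      rw [Real.volume_Icc, ENNReal.toReal_ofReal (by linarith)]
    rw [hlen]
    ring
  · intro K Z hK hKne hZ hZne t ht
    have h1 := hK.image φ.continuous
    have h2 := (hZ.image φ.continuous).smul t
    have hn := hKne.image φ
    have hn2 : (t • φ '' Z).Nonempty := (hZne.image φ).smul_set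
    simp only [Set.image_add, image_smul_set]
    rw [csSup_add hn h1.bddAbove hn2 h2.bddAbove, csInf_add hn h1.bddBelow hn2 h2.bddBelow,
      Real.sSup_smul_of_nonneg ht, Real.sInf_smul_of_nonneg ht, smul_eq_mul, smul_eq_mul]
    ring

/-- The Steiner formula with the disc replaced by a finite Minkowski sum of segments. -/
theorem steiner_sum_segment {ι : Type*} (s : Finset ι) (u : ι → EuclideanSpace ℝ (Fin 2)) :
    IsCompact (∑ i ∈ s, segment ℝ (-u i) (u i)) ∧ (∑ i ∈ s, segment ℝ (-u i) (u i)).Nonempty ∧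
    ∀ K : Set (EuclideanSpace ℝ (Fin 2)), IsCompact K → Convex ℝ K → K.Nonempty →
      ∃ L : ℝ, 0 ≤ L ∧ ∀ t : ℝ, 0 ≤ t →
        volume.real (K + t • ∑ i ∈ s, segment ℝ (-u i) (u i))
          = volume.real K + L * t + volume.real (∑ i ∈ s, segment ℝ (-u i) (u i)) * t ^ 2 := by
  classical
  induction s using Finset.induction_on with
  | empty =>
    refine ⟨by simp, by simp, fun K _ _ _ => ⟨0, le_rfl, fun t _ => ?_⟩⟩
    simp [Measure.real, ← Set.singleton_zero]
  | insert i s hi ih =>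
    obtain ⟨hc, hne, hst⟩ := ih
    obtain ⟨W, hW0, hWv, hWadd⟩ := exists_volume_add_smul_segment (u i)
    rw [Finset.sum_insert hi]
    set Z := ∑ i ∈ s, segment ℝ (-u i) (u i) with hZ
    have hconv : Convex ℝ Z := convex_sum _ fun j _ => convex_segment _ _
    have hsc : IsCompact (segment ℝ (-u i) (u i)) := by
      rw [segment_eq_image_lineMap]
      exact isCompact_Icc.image AffineMap.lineMap_continuous
    refine ⟨hsc.add hc, Set.Nonempty.add ⟨_, left_mem_segment _ _ _⟩ hne,
      fun K hK hKconv hKne => ?_⟩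
    obtain ⟨L, hL, hLt⟩ := hst K hK hKconv hKne
    refine ⟨L + W K, add_nonneg hL (hW0 K hK), fun t ht => ?_⟩
    have h1 := hWv Z hc hconv hne 1 zero_le_one
    rw [one_smul, add_comm Z, one_mul] at h1
    rw [h1, smul_add, add_comm (t • segment ℝ _ _), ← add_assoc,
      hWv _ (hK.add (hc.smul t)) (hKconv.add (hconv.smul t)) (hKne.add hne.smul_set) t ht,
      hWadd K Z hK hKne hc hne t ht, hLt t ht]
    ring

/-- Bounds on the support function of a finite sum of segments bound the sum itself. -/
theorem closedBall_subset_sum_segment_subset {ι E : Type*} [NormedAddCommGroup E]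
    [InnerProductSpace ℝ E] [CompleteSpace E] (s : Finset ι) (u : ι → E) {r : ℝ}
    (hr : 0 ≤ r) (hclosed : IsClosed (∑ i ∈ s, segment ℝ (-u i) (u i)))
    (hlow : ∀ y, ‖y‖ ≤ ∑ i ∈ s, |inner ℝ y (u i)|)
    (hupp : ∀ y, ∑ i ∈ s, |inner ℝ y (u i)| ≤ r * ‖y‖) :
    closedBall 0 1 ⊆ ∑ i ∈ s, segment ℝ (-u i) (u i) ∧
      ∑ i ∈ s, segment ℝ (-u i) (u i) ⊆ closedBall 0 r := by
  have hseg (v : E) (a : ℝ) (ha : |a| ≤ 1) : a • v ∈ segment ℝ (-v) v := by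
    obtain ⟨h1, h2⟩ := abs_le.1 ha
    refine ⟨(1 - a) / 2, (1 + a) / 2, by linarith, by linarith, by ring, ?_⟩
    module
  constructor
  · intro x hx
    by_contra hxZ
    obtain ⟨f, c, hf, hc⟩ := geometric_hahn_banach_closed_point
      (convex_sum _ fun i _ => convex_segment (-u i) (u i)) hclosed hxZ
    obtain ⟨y, rfl⟩ := (InnerProductSpace.toDual ℝ E).surjective f
    simp only [InnerProductSpace.toDual_apply_apply] at hf hc
    have h1 := hf (∑ i ∈ s, (SignType.sign (inner ℝ y (u i)) : ℝ) • u i)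
      (Set.finsetSum_mem_finsetSum _ _ _ fun i _ => hseg _ _ (by
        rcases SignType.sign (inner ℝ y (u i)) with _ | _ | _ <;> simp))
    simp only [inner_sum, inner_smul_right, sign_mul_self] at h1
    have h2 := real_inner_le_norm y x
    have h3 : ‖x‖ ≤ 1 := by simpa using hx
    nlinarith [hlow y, norm_nonneg y]
  · intro z hz
    obtain ⟨g, hg, hgz⟩ := (Set.mem_finsetSum _ _ _).1 hz
    have hle : ∑ i ∈ s, inner ℝ z (g i) ≤ ∑ i ∈ s, |inner ℝ z (u i)| := by
      refine Finset.sum_le_sum fun i hi => ?_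
      obtain ⟨a, b, ha, hb, hab, hgi⟩ := hg hi
      rw [← hgi, inner_add_right, inner_smul_right, inner_smul_right, inner_neg_right]
      nlinarith [le_abs_self (inner ℝ z (u i)), neg_le_abs (inner ℝ z (u i))]
    rw [← inner_sum, hgz, real_inner_self_eq_norm_sq] at hle
    have := hupp z
    rw [mem_closedBall_zero_iff]
    rcases (norm_nonneg z).eq_or_lt with h0 | hpos
    · rwa [← h0]
    · nlinarith

/-- The sum of `|cos|` over `n` equally spaced angles is constant up to a bounded error. -/
theorem sum_abs_cos_sub_le {n : ℕ} (hn : 0 < n) (θ θ' : ℝ) :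
    |(∑ k ∈ Finset.range n, |Real.cos (θ + Real.pi * k / n)|)
      - (∑ k ∈ Finset.range n, |Real.cos (θ' + Real.pi * k / n)|)| ≤ Real.pi := by
  have hn' : (0 : ℝ) < n := by exact_mod_cast hn
  set h : ℝ → ℝ := fun θ => ∑ k ∈ Finset.range n, |Real.cos (θ + Real.pi * k / n)| with hh
  have hper : Function.Periodic h (Real.pi / n) := by
    intro θ
    have h1 := Finset.sum_range_succ (fun k : ℕ => |Real.cos (θ + Real.pi * k / n)|) n
    have h2 := Finset.sum_range_succ' (fun k : ℕ => |Real.cos (θ + Real.pi * k / n)|) n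
    have h3 : |Real.cos (θ + Real.pi * n / n)| = |Real.cos (θ + Real.pi * (0 : ℕ) / n)| := by
      rw [mul_div_cancel_right₀ _ hn'.ne', Real.cos_add_pi]
      simp
    have h4 : h (θ + Real.pi / n)
        = ∑ k ∈ Finset.range n, |Real.cos (θ + Real.pi * (k + 1 : ℕ) / n)| := by
      refine Finset.sum_congr rfl fun k _ => ?_
      congr 2
      push_cast
      ring
    rw [h4]
    show _ = ∑ k ∈ Finset.range n, |Real.cos (θ + Real.pi * k / n)|
    linarith
  have hlip (a b : ℝ) : |h a - h b| ≤ n * |a - b| := by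
    rw [hh]
    simp only
    rw [← Finset.sum_sub_distrib]
    refine (Finset.abs_sum_le_sum_abs _ _).trans ((Finset.sum_le_card_nsmul _ _ |a - b| ?_).trans ?_)
    · intro k _
      refine (abs_abs_sub_abs_le _ _).trans ?_
      have := Real.abs_cos_sub_cos_le (a + Real.pi * k / n) (b + Real.pi * k / n)
      simpa using this
    · simp
  have hpos : 0 < Real.pi / n := div_pos Real.pi_pos hn'
  obtain ⟨a, ha, hha⟩ := hper.exists_mem_Ico₀ hpos θ
  obtain ⟨b, hb, hhb⟩ := hper.exists_mem_Ico₀ hpos θ'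
  change |h θ - h θ'| ≤ _
  rw [hha, hhb]
  refine (hlip a b).trans ?_
  have : |a - b| ≤ Real.pi / n := by
    rw [abs_le]
    constructor <;> linarith [ha.1, ha.2, hb.1, hb.2]
  calc n * |a - b| ≤ n * (Real.pi / n) := by gcongr
    _ = Real.pi := by field_simp

/-- The sum of `|cos|` over `n` equally spaced angles grows linearly in `n`. -/
theorem le_sum_abs_cos {n : ℕ} (hn : 0 < n) (θ : ℝ) :
    (n - Real.pi) / 2 ≤ ∑ k ∈ Finset.range n, |Real.cos (θ + Real.pi * k / n)| := by
  have h1 := (abs_le.1 (sum_abs_cos_sub_le hn θ (θ + Real.pi / 2))).1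
  have h2 : (n : ℝ) ≤ ∑ k ∈ Finset.range n, |Real.cos (θ + Real.pi * k / n)|
      + ∑ k ∈ Finset.range n, |Real.cos (θ + Real.pi / 2 + Real.pi * k / n)| := by
    rw [← Finset.sum_add_distrib]
    have : (n : ℝ) = ∑ k ∈ Finset.range n, (1 : ℝ) := by simp
    conv_lhs => rw [this]
    refine Finset.sum_le_sum fun k _ => ?_
    rw [show θ + Real.pi / 2 + Real.pi * k / n = θ + Real.pi * k / n + Real.pi / 2 by ring,
      Real.cos_add_pi_div_two, abs_neg]
    have := Real.sin_sq_add_cos_sq (θ + Real.pi * k / n)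
    rw [← sq_abs (Real.sin _), ← sq_abs (Real.cos _)] at this
    nlinarith [abs_nonneg (Real.sin (θ + Real.pi * k / n)),
      abs_nonneg (Real.cos (θ + Real.pi * k / n))]
  linarith

/-- The Euclidean norm on the plane is approximated by zonogonal norms. -/
theorem exists_sum_abs_inner_approx {ε : ℝ} (hε : 0 < ε) :
    ∃ (n : ℕ) (u : ℕ → EuclideanSpace ℝ (Fin 2)), ∀ y,
      ‖y‖ ≤ ∑ k ∈ Finset.range n, |inner ℝ y (u k)| ∧
      ∑ k ∈ Finset.range n, |inner ℝ y (u k)| ≤ (1 + ε) * ‖y‖ := by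
  obtain ⟨n, hn⟩ := exists_nat_gt (3 * Real.pi + 4 * Real.pi / ε)
  have hπ := Real.pi_pos
  have hεπ : 0 < 4 * Real.pi / ε := by positivity
  have hn0 : 0 < n := by
    have : (0 : ℝ) < n := by linarith
    exact_mod_cast this
  set h : ℝ → ℝ := fun θ => ∑ k ∈ Finset.range n, |Real.cos (θ + Real.pi * k / n)| with hh
  obtain ⟨a, ha0, ha⟩ : ∃ a : ℝ, 2 * Real.pi / ε < a ∧ a = h 0 - Real.pi := by
    refine ⟨_, ?_, rfl⟩
    have : (n - Real.pi) / 2 ≤ h 0 := le_sum_abs_cos hn0 0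
    have e : 4 * Real.pi / ε = 2 * (2 * Real.pi / ε) := by ring
    linarith
  have hapos : 0 < a := lt_trans (by positivity) ha0
  have haε : 2 * Real.pi ≤ ε * a := by
    rw [div_lt_iff₀ hε] at ha0
    linarith
  refine ⟨n, fun k => a⁻¹ • !₂[Real.cos (Real.pi * k / n), -Real.sin (Real.pi * k / n)],
    fun y => ?_⟩
  obtain ⟨θ, h0, h1⟩ : ∃ θ : ℝ, y 0 = ‖y‖ * Real.cos θ ∧ y 1 = ‖y‖ * Real.sin θ := by
    refine ⟨(⟨y 0, y 1⟩ : ℂ).arg, ?_⟩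
    have hnorm : ‖y‖ = ‖(⟨y 0, y 1⟩ : ℂ)‖ := by
      rw [EuclideanSpace.norm_eq, Complex.norm_def, Complex.normSq_mk]
      simp [Fin.sum_univ_two, sq]
    rw [hnorm, Complex.norm_mul_cos_arg, Complex.norm_mul_sin_arg]
    exact ⟨rfl, rfl⟩
  have hsum : ∑ k ∈ Finset.range n, |inner ℝ y
      (a⁻¹ • !₂[Real.cos (Real.pi * k / n), -Real.sin (Real.pi * k / n)])|
      = ‖y‖ * (a⁻¹ * h θ) := by
    rw [hh]
    simp only [Finset.mul_sum]
    refine Finset.sum_congr rfl fun k _ => ?_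
    rw [inner_smul_right, PiLp.inner_apply]
    have : a⁻¹ * ∑ i, inner ℝ (y i)
        (!₂[Real.cos (Real.pi * k / n), -Real.sin (Real.pi * k / n)] i)
        = ‖y‖ * (a⁻¹ * Real.cos (θ + Real.pi * k / n)) := by
      simp only [Fin.sum_univ_two, h0, h1, Real.cos_add]
      simp
      ring
    rw [this, abs_mul, abs_mul, abs_norm, abs_of_pos (inv_pos.2 hapos)]
  obtain ⟨hl, hu⟩ := abs_le.1 (sum_abs_cos_sub_le hn0 θ 0)
  change -Real.pi ≤ h θ - h 0 at hl
  change h θ - h 0 ≤ Real.pi at hu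
  rw [hsum]
  have hlow : 1 ≤ a⁻¹ * h θ := by
    rw [inv_mul_eq_div, le_div_iff₀ hapos]
    linarith
  have hupp : a⁻¹ * h θ ≤ 1 + ε := by
    rw [inv_mul_eq_div, div_le_iff₀ hapos]
    linarith
  constructor <;> nlinarith [norm_nonneg y]

/-- A sequence of bodies squeezed between the unit disc and shrinking discs has parallel areas
converging to those of the disc. -/
theorem tendsto_volume_add_smul {K : Set (EuclideanSpace ℝ (Fin 2))} (hK : IsCompact K)
    {Z : ℕ → Set (EuclideanSpace ℝ (Fin 2))} {ε : ℕ → ℝ} (hε : ∀ n, 0 ≤ ε n)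
    (hlim : Filter.Tendsto ε Filter.atTop (nhds 0))
    (hl : ∀ n, closedBall 0 1 ⊆ Z n) (hu : ∀ n, Z n ⊆ closedBall 0 (1 + ε n))
    {t : ℝ} (ht : 0 ≤ t) :
    Filter.Tendsto (fun n => volume.real (K + t • Z n)) Filter.atTop
      (nhds (volume.real (K + t • closedBall (0 : EuclideanSpace ℝ (Fin 2)) 1))) := by
  have hball (r : ℝ) (hr : 0 ≤ r) :
      t • closedBall (0 : EuclideanSpace ℝ (Fin 2)) r = closedBall 0 (t * r) := by
    rw [smul_closedBall _ _ hr, smul_zero, Real.norm_of_nonneg ht]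
  have hcomp : IsCompact (K + t • closedBall (0 : EuclideanSpace ℝ (Fin 2)) 1) :=
    hK.add ((isCompact_closedBall _ _).smul t)
  have hup (n : ℕ) : K + t • closedBall (0 : EuclideanSpace ℝ (Fin 2)) (1 + ε n)
      = cthickening (t * ε n) (K + t • closedBall (0 : EuclideanSpace ℝ (Fin 2)) 1) := by
    have := hε n
    rw [hball _ (by linarith), hball _ zero_le_one, mul_one,
      hK.add_closedBall_zero (by positivity), hK.add_closedBall_zero ht,
      cthickening_cthickening (by positivity) ht]
    congr 1
    ring
  have htend : Filter.Tendsto (fun n => t * ε n) Filter.atTop (nhds 0) := by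
    simpa using hlim.const_mul t
  have hconv := (ENNReal.tendsto_toReal hcomp.measure_lt_top.ne).comp
    ((tendsto_measure_cthickening_of_isCompact (μ := volume) hcomp).comp htend)
  refine tendsto_of_tendsto_of_tendsto_of_le_of_le tendsto_const_nhds hconv (fun n => ?_)
    (fun n => ?_)
  · refine measureReal_mono (Set.add_subset_add_left (Set.smul_set_mono (hl n))) ?_
    refine (lt_of_le_of_lt (measure_mono
      (Set.add_subset_add_left (Set.smul_set_mono (hu n)))) ?_).ne
    exact (hK.add ((isCompact_closedBall _ _).smul t)).measure_lt_top
  · have := hup n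
    simp only [Function.comp]
    rw [← this]
    exact measureReal_mono (Set.add_subset_add_left (Set.smul_set_mono (hu n)))
      (hK.add ((isCompact_closedBall _ _).smul t)).measure_lt_top.ne

/-- **Planar Steiner formula.** For every convex body `K ⊆ ℝ²` there is `L ≥ 0`
(the perimeter of `K`) so that the area of `K + tB` equals `A_K + L t + π t²`. -/
theorem planar_steiner_formula (K : Set (EuclideanSpace ℝ (Fin 2)))
    (hKne : K.Nonempty) (hKcomp : IsCompact K) (hKconv : Convex ℝ K) :
    ∃ L : ℝ, 0 ≤ L ∧ ∀ t : ℝ, 0 ≤ t →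
      (volume (K + t • closedBall (0 : EuclideanSpace ℝ (Fin 2)) 1)).toReal
        = (volume K).toReal + L * t + Real.pi * t ^ 2 := by
  have hεpos (n : ℕ) : (0 : ℝ) < 1 / (n + 1) := Nat.one_div_pos_of_nat
  choose N u hNu using fun n : ℕ => exists_sum_abs_inner_approx (hεpos n)
  choose hZc _ hZs using fun n : ℕ => steiner_sum_segment (Finset.range (N n)) (u n)
  set Z : ℕ → Set (EuclideanSpace ℝ (Fin 2)) :=
    fun n => ∑ k ∈ Finset.range (N n), segment ℝ (-u n k) (u n k) with hZ
  choose hl hu using fun n : ℕ => closedBall_subset_sum_segment_subset (Finset.range (N n)) (u n)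
    (by have := hεpos n; positivity) (hZc n).isClosed (fun y => (hNu n y).1) (fun y => (hNu n y).2)
  choose L hL0 hL using fun n => hZs n K hKcomp hKconv hKne
  have hlim {K' : Set (EuclideanSpace ℝ (Fin 2))} (hK' : IsCompact K') {t : ℝ} (ht : 0 ≤ t) :=
    tendsto_volume_add_smul hK' (Z := Z) (fun n => (hεpos n).le)
      tendsto_one_div_add_atTop_nhds_zero_nat hl hu ht
  have hpi : volume.real (closedBall (0 : EuclideanSpace ℝ (Fin 2)) 1) = Real.pi := by
    simp [Measure.real, EuclideanSpace.volume_closedBall_fin_two, Real.pi_pos.le]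
  have hZlim : Filter.Tendsto (fun n => volume.real (Z n)) Filter.atTop (nhds Real.pi) := by
    simpa [hpi] using hlim (isCompact_singleton (x := 0)) zero_le_one
  have hLlim : Filter.Tendsto L Filter.atTop (nhds
      (volume.real (K + (1 : ℝ) • closedBall (0 : EuclideanSpace ℝ (Fin 2)) 1)
        - volume.real K - Real.pi)) := by
    refine (((hlim hKcomp zero_le_one).sub_const (volume.real K)).sub hZlim).congr fun n => ?_
    rw [hL n 1 zero_le_one]
    ring
  refine ⟨_, ge_of_tendsto' hLlim hL0, fun t ht => ?_⟩
  refine tendsto_nhds_unique (hlim hKcomp ht) ?_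
  refine (((hLlim.mul_const t).const_add (volume.real K)).add (hZlim.mul_const (t ^ 2))).congr
    fun n => ?_
  exact (hL n t ht).symm
end

section
/- Let K ⊆ ℝ² be a convex body with area A = vol(K), and suppose L ∈ ℝ satisfies vol(K + tB) = A + L·t + π·t² for all t ≥ 0. Then L² − 4πA ≥ 0 (equivalently, the Steiner polynomial π t² + L t + A has only real roots, which is equivalent to the isoperimetric inequality), and if A > 0 then every real root t₀ of π t² + L t + A satisfies t₀ < 0. -/
open MeasureTheory Metric Pointwise

/-- One-dimensional Brunn–Minkowski inequality for compact sets. -/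
theorem IsCompact.volume_add_volume_le_volume_add {s t : Set ℝ} (hs : IsCompact s)
    (ht : IsCompact t) (hsne : s.Nonempty) (htne : t.Nonempty) :
    volume s + volume t ≤ volume (s + t) := by
  set a := sSup s
  set b := sInf t
  have ha : a ∈ s := hs.sSup_mem hsne
  have hb : b ∈ t := ht.sInf_mem htne
  have hinter : (b +ᵥ s) ∩ (a +ᵥ t) ⊆ {a + b} := by
    rintro _ ⟨⟨x, hx, rfl⟩, y, hy, hxy⟩
    have hxa : x ≤ a := le_csSup hs.bddAbove hx
    have hby : b ≤ y := csInf_le ht.bddBelow hy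
    simp only [vadd_eq_add, Set.mem_singleton_iff] at hxy ⊢
    linarith
  have hunion : (b +ᵥ s) ∪ (a +ᵥ t) ⊆ s + t := by
    rintro _ (⟨x, hx, rfl⟩ | ⟨y, hy, rfl⟩)
    · exact ⟨x, hx, b, hb, add_comm _ _⟩
    · exact ⟨a, ha, y, hy, rfl⟩
  have hnull : volume ((b +ᵥ s) ∩ (a +ᵥ t)) = 0 :=
    measure_mono_null hinter (measure_singleton _)
  calc volume s + volume t = volume (b +ᵥ s) + volume (a +ᵥ t) := by
        simp only [measure_vadd]
    _ = volume ((b +ᵥ s) ∪ (a +ᵥ t)) := by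
        rw [← measure_union_add_inter _ (ht.vadd a).measurableSet, hnull, add_zero]
    _ ≤ volume (s + t) := measure_mono hunion

/-- One-dimensional Brunn–Minkowski inequality for measurable sets. -/
theorem MeasurableSet.volume_add_volume_le_volume_add {s t : Set ℝ} (hs : MeasurableSet s)
    (ht : MeasurableSet t) (hsne : s.Nonempty) (htne : t.Nonempty) :
    volume s + volume t ≤ volume (s + t) := by
  obtain ⟨x, hx⟩ := hsne
  obtain ⟨y, hy⟩ := htne
  rw [hs.measure_eq_iSup_isCompact, ht.measure_eq_iSup_isCompact]
  simp only [iSup_and']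
  refine ENNReal.biSup_add_biSup_le' ⟨∅, by simp⟩ ⟨∅, by simp⟩ ?_
  rintro u ⟨hus, hu⟩ v ⟨hvt, hv⟩
  calc volume u + volume v ≤ volume (insert x u) + volume (insert y v) := by
        gcongr <;> exact Set.subset_insert _ _
    _ ≤ volume (insert x u + insert y v) :=
        (hu.insert x).volume_add_volume_le_volume_add (hv.insert y)
          (Set.insert_nonempty _ _) (Set.insert_nonempty _ _)
    _ ≤ volume (s + t) := measure_mono <|
        Set.add_subset_add (Set.insert_subset hx hus) (Set.insert_subset hy hvt)

theorem lintegral_div_iSup_eq_setLIntegral_Ioo {f : ℝ → ℝ} (hf : Measurable f)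
    (hf0 : 0 ≤ f) (hfb : BddAbove (Set.range f)) (hpos : 0 < ⨆ x, f x) :
    ∫⁻ x, ENNReal.ofReal (f x / ⨆ x, f x) =
      ∫⁻ r in Set.Ioo 0 1, volume {x | r * (⨆ x, f x) < f x} := by
  rw [lintegral_eq_lintegral_meas_lt _
    (Filter.Eventually.of_forall fun x => div_nonneg (hf0 x) hpos.le)
    (hf.div_const _).aemeasurable]
  simp only [lt_div_iff₀ hpos]
  rw [← Set.Ioo_union_Ici_eq_Ioi (zero_lt_one' ℝ), lintegral_union measurableSet_Ici
    (Set.disjoint_left.2 fun x hx hx' => not_le.2 hx.2 hx')]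
  refine (congrArg _ ?_).trans (add_zero _)
  refine (setLIntegral_congr_fun measurableSet_Ici fun r (hr : 1 ≤ r) => ?_).trans lintegral_zero
  have : {x | r * (⨆ x, f x) < f x} = ∅ := Set.eq_empty_of_forall_notMem fun x hx => by
    have := le_ciSup hfb x
    have hx : r * (⨆ x, f x) < f x := hx
    nlinarith
  simp [this]

/-- A functional form of the two-dimensional Brunn–Minkowski inequality. -/
theorem lintegral_div_iSup_add_lintegral_div_iSup_le {f g h : ℝ → ℝ}
    (hf : Measurable f) (hg : Measurable g) (hh : Measurable h)
    (hf0 : 0 ≤ f) (hg0 : 0 ≤ g) (hh0 : 0 ≤ h)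
    (hfb : BddAbove (Set.range f)) (hgb : BddAbove (Set.range g))
    (hfpos : 0 < ⨆ x, f x) (hgpos : 0 < ⨆ x, g x)
    (hadd : ∀ x y, 0 < f x → 0 < g y → f x + g y ≤ h (x + y)) :
    (∫⁻ x, ENNReal.ofReal (f x / ⨆ x, f x)) + ∫⁻ x, ENNReal.ofReal (g x / ⨆ x, g x) ≤
      ∫⁻ x, ENNReal.ofReal (h x / ((⨆ x, f x) + ⨆ x, g x)) := by
  rw [lintegral_div_iSup_eq_setLIntegral_Ioo hf hf0 hfb hfpos,
    lintegral_div_iSup_eq_setLIntegral_Ioo hg hg0 hgb hgpos]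
  set M := ⨆ x, f x
  set N := ⨆ x, g x
  rw [lintegral_eq_lintegral_meas_lt _
    (Filter.Eventually.of_forall fun x => div_nonneg (hh0 x) (add_pos hfpos hgpos).le)
    (hh.div_const _).aemeasurable]
  have hanti : Antitone fun r : ℝ => volume {x | r * M < f x} := fun r r' hr =>
    measure_mono fun x (hx : r' * M < f x) =>
      show r * M < f x from (mul_le_mul_of_nonneg_right hr hfpos.le).trans_lt hx
  rw [← lintegral_add_left hanti.measurable]
  refine (setLIntegral_mono' measurableSet_Ioo fun r hr => ?_).trans
    (lintegral_mono_set Set.Ioo_subset_Ioi_self)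
  refine (MeasurableSet.volume_add_volume_le_volume_add
    (measurableSet_lt measurable_const hf) (measurableSet_lt measurable_const hg)
    (exists_lt_of_lt_ciSup (mul_lt_of_lt_one_left hfpos hr.2))
    (exists_lt_of_lt_ciSup (mul_lt_of_lt_one_left hgpos hr.2))).trans (measure_mono ?_)
  rintro _ ⟨x, hx : r * M < f x, y, hy : r * N < g y, rfl⟩
  have := hadd x y ((mul_pos hr.1 hfpos).trans hx) ((mul_pos hr.1 hgpos).trans hy)
  simp only [Set.mem_ofPred_eq, lt_div_iff₀ (add_pos hfpos hgpos)]
  linarith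

section Slices

variable {s t : Set (ℝ × ℝ)}

theorem IsCompact.preimage_prodMk (hs : IsCompact s) (x : ℝ) :
    IsCompact (Prod.mk x ⁻¹' s) :=
  (hs.image continuous_snd).of_isClosed_subset
    (hs.isClosed.preimage (Continuous.prodMk_right x)) fun y hy => ⟨(x, y), hy, rfl⟩

theorem IsCompact.bddAbove_volume_preimage_prodMk (hs : IsCompact s) :
    BddAbove (Set.range fun x => volume.real (Prod.mk x ⁻¹' s)) := by
  refine ⟨volume.real (Prod.snd '' s), ?_⟩
  rintro _ ⟨x, rfl⟩
  exact measureReal_mono (fun y hy => ⟨(x, y), hy, rfl⟩)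
    (hs.image continuous_snd).measure_lt_top.ne

theorem IsCompact.measurable_volume_preimage_prodMk (hs : IsCompact s) :
    Measurable fun x => volume.real (Prod.mk x ⁻¹' s) :=
  (measurable_measure_prodMk_left hs.measurableSet).ennreal_toReal

theorem IsCompact.lintegral_volume_preimage_prodMk_div (hs : IsCompact s) (c : ℝ) :
    ∫⁻ x, ENNReal.ofReal (volume.real (Prod.mk x ⁻¹' s) / c) =
      ENNReal.ofReal (volume.real s / c) := by
  have hfin (x : ℝ) : volume (Prod.mk x ⁻¹' s) ≠ ⊤ :=
    (hs.preimage_prodMk x).measure_lt_top.ne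
  simp only [div_eq_mul_inv, ENNReal.ofReal_mul measureReal_nonneg]
  rw [lintegral_mul_const _ hs.measurable_volume_preimage_prodMk.ennreal_ofReal]
  simp only [ofReal_measureReal (hfin _), ofReal_measureReal hs.measure_lt_top.ne]
  rw [Measure.volume_eq_prod, Measure.prod_apply hs.measurableSet]

theorem IsCompact.iSup_volume_preimage_prodMk_pos (hs : IsCompact s) (hpos : 0 < volume.real s) :
    0 < ⨆ x, volume.real (Prod.mk x ⁻¹' s) := by
  by_contra! hle
  have hzero (x : ℝ) : volume.real (Prod.mk x ⁻¹' s) = 0 :=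
    le_antisymm ((le_ciSup hs.bddAbove_volume_preimage_prodMk x).trans hle) measureReal_nonneg
  have := hs.lintegral_volume_preimage_prodMk_div 1
  simp only [hzero, ENNReal.ofReal_zero, lintegral_zero, div_one] at this
  exact hpos.not_ge (ENNReal.ofReal_eq_zero.1 this.symm)

/-- Brunn–Minkowski inequality for compact sets in `ℝ × ℝ`. -/
theorem IsCompact.volume_add_two_mul_sqrt_add_volume_le (hs : IsCompact s) (ht : IsCompact t)
    (hspos : 0 < volume.real s) (htpos : 0 < volume.real t) :
    volume.real s + 2 * √(volume.real s * volume.real t) + volume.real t ≤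
      volume.real (s + t) := by
  have hM := hs.iSup_volume_preimage_prodMk_pos hspos
  have hN := ht.iSup_volume_preimage_prodMk_pos htpos
  have key := lintegral_div_iSup_add_lintegral_div_iSup_le
    hs.measurable_volume_preimage_prodMk ht.measurable_volume_preimage_prodMk
    (hs.add ht).measurable_volume_preimage_prodMk
    (fun _ => measureReal_nonneg) (fun _ => measureReal_nonneg) (fun _ => measureReal_nonneg)
    hs.bddAbove_volume_preimage_prodMk ht.bddAbove_volume_preimage_prodMk hM hN ?_
  · set M := ⨆ x, volume.real (Prod.mk x ⁻¹' s)
    set N := ⨆ x, volume.real (Prod.mk x ⁻¹' t)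
    rw [hs.lintegral_volume_preimage_prodMk_div M, ht.lintegral_volume_preimage_prodMk_div N,
      (hs.add ht).lintegral_volume_preimage_prodMk_div (M + N),
      ← ENNReal.ofReal_add (by positivity) (by positivity),
      ENNReal.ofReal_le_ofReal_iff (by positivity), le_div_iff₀ (add_pos hM hN)] at key
    refine le_trans ?_ key
    set a := volume.real s
    set b := volume.real t
    have hamgm : 2 * √(a * b) ≤ a * N / M + b * M / N := by
      have hprod : a * b = (a * N / M) * (b * M / N) := by field_simp
      rw [hprod, Real.sqrt_mul (by positivity)]
      nlinarith [sq_nonneg (√(a * N / M) - √(b * M / N)),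
        Real.sq_sqrt (show 0 ≤ a * N / M by positivity),
        Real.sq_sqrt (show 0 ≤ b * M / N by positivity)]
    have hexpand : (a / M + b / N) * (M + N) = a + (a * N / M + b * M / N) + b := by
      field_simp
      ring
    rw [hexpand]
    linarith
  · intro x y hx hy
    have hsx := hs.preimage_prodMk x
    have hty := ht.preimage_prodMk y
    have hsub : Prod.mk x ⁻¹' s + Prod.mk y ⁻¹' t ⊆ Prod.mk (x + y) ⁻¹' (s + t) := by
      rintro _ ⟨u, hu, v, hv, rfl⟩
      exact ⟨(x, u), hu, (y, v), hv, rfl⟩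
    have hle := (hsx.volume_add_volume_le_volume_add hty
      (nonempty_of_measureReal_ne_zero hx.ne') (nonempty_of_measureReal_ne_zero hy.ne')).trans
      (measure_mono hsub)
    have := ENNReal.toReal_mono ((hs.add ht).preimage_prodMk _).measure_lt_top.ne hle
    rwa [ENNReal.toReal_add hsx.measure_lt_top.ne hty.measure_lt_top.ne] at this

end Slices

/-- Brunn–Minkowski inequality for compact sets in the Euclidean plane. -/
theorem EuclideanSpace.volume_add_two_mul_sqrt_add_volume_le
    {s t : Set (EuclideanSpace ℝ (Fin 2))} (hs : IsCompact s) (ht : IsCompact t)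
    (hspos : 0 < volume.real s) (htpos : 0 < volume.real t) :
    volume.real s + 2 * √(volume.real s * volume.real t) + volume.real t ≤
      volume.real (s + t) := by
  let e : EuclideanSpace ℝ (Fin 2) ≃L[ℝ] ℝ × ℝ :=
    (EuclideanSpace.equiv (Fin 2) ℝ).trans (ContinuousLinearEquiv.finTwoArrow ℝ ℝ)
  have he : MeasurePreserving e :=
    (volume_preserving_finTwoArrow ℝ).comp (PiLp.volume_preserving_ofLp (Fin 2))
  have himage {u : Set (EuclideanSpace ℝ (Fin 2))} (hu : IsCompact u) :
      volume.real (e '' u) = volume.real u := by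
    rw [← he.measureReal_preimage (hu.image e.continuous).measurableSet.nullMeasurableSet,
      e.injective.preimage_image]
  have := (hs.image e.continuous).volume_add_two_mul_sqrt_add_volume_le (ht.image e.continuous)
    (by rwa [himage hs]) (by rwa [himage ht])
  rwa [← Set.image_add, himage hs, himage ht, himage (hs.add ht)] at this

/-- For a planar convex body `K` with area `A` and Steiner polynomial
`S_K(t) = A + L t + π t²`, the discriminant satisfies `L² - 4πA ≥ 0` (so the roots are
real; this is the isoperimetric inequality), and if `A > 0` every real root is negative. -/
theorem planar_steiner_real_negative_roots (K : Set (EuclideanSpace ℝ (Fin 2)))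
    (hKne : K.Nonempty) (hKcomp : IsCompact K) (hKconv : Convex ℝ K) (L : ℝ)
    (hL : ∀ t : ℝ, 0 ≤ t →
      (volume (K + t • closedBall (0 : EuclideanSpace ℝ (Fin 2)) 1)).toReal
        = (volume K).toReal + L * t + Real.pi * t ^ 2) :
    0 ≤ L ^ 2 - 4 * Real.pi * (volume K).toReal ∧
    (0 < (volume K).toReal → ∀ t₀ : ℝ,
      Real.pi * t₀ ^ 2 + L * t₀ + (volume K).toReal = 0 → t₀ < 0) := by
  have hball : volume.real (closedBall (0 : EuclideanSpace ℝ (Fin 2)) 1) = Real.pi := by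
    simp [Measure.real, EuclideanSpace.volume_closedBall_fin_two, Real.pi_pos.le]
  have hperim (hpos : 0 < (volume K).toReal) :
      2 * √((volume K).toReal * Real.pi) ≤ L := by
    have hBM := EuclideanSpace.volume_add_two_mul_sqrt_add_volume_le hKcomp
      (isCompact_closedBall (0 : EuclideanSpace ℝ (Fin 2)) 1) hpos (hball ▸ Real.pi_pos)
    have hsteiner := hL 1 zero_le_one
    rw [one_smul] at hsteiner
    rw [hball] at hBM
    simp only [Measure.real, hsteiner] at hBM
    linarith
  refine ⟨?_, fun hpos t₀ ht₀ => ?_⟩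
  · rcases ENNReal.toReal_nonneg.eq_or_lt' with hzero | hpos
    · rw [hzero]
      nlinarith [sq_nonneg L]
    · have hsq := Real.sq_sqrt (mul_pos hpos Real.pi_pos).le
      nlinarith [hperim hpos, Real.sqrt_nonneg ((volume K).toReal * Real.pi)]
  · have hLpos : 0 ≤ L := le_trans (by positivity) (hperim hpos)
    by_contra! hnonneg
    have : 0 ≤ Real.pi * t₀ ^ 2 := by positivity
    nlinarith [mul_nonneg hLpos hnonneg]
end

section
/- Let K ⊆ ℝ² be a convex body with nonempty interior which is not a Euclidean disc (i.e., K is not a closed ball). Let L ∈ ℝ satisfy vol(K + tB) = vol(K) + L·t + π·t² for all t ≥ 0 (so L is the perimeter of K), let R_i be the inradius of K and R_e the circumradius of K. Then 2π·R_i < L < 2π·R_e; equivalently, −R_e < −L/(2π) < −R_i. -/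
open MeasureTheory Metric Pointwise

lemma volume_real_closedBall_fin_two (x : EuclideanSpace ℝ (Fin 2)) {r : ℝ} (hr : 0 ≤ r) :
    volume.real (closedBall x r) = Real.pi * r ^ 2 := by
  rw [measureReal_def, EuclideanSpace.volume_closedBall_fin_two, ENNReal.toReal_mul,
    ENNReal.toReal_pow, ENNReal.toReal_ofReal hr, ENNReal.toReal_ofReal Real.pi_pos.le, mul_comm]

/-- The area of an annular sector over an open cone. -/
lemma exists_volume_real_sector {A : Set (EuclideanSpace ℝ (Fin 2))} (hA : IsOpen A)
    (hcone : ∀ s : ℝ, 0 < s → ∀ z ∈ A, s • z ∈ A) (hne : A.Nonempty) :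
    ∃ a : ℝ, 0 < a ∧ ∀ s s' : ℝ, 0 < s → s ≤ s' →
      volume.real ((A ∩ closedBall 0 s') \ closedBall 0 s) = a * (s' ^ 2 - s ^ 2) := by
  have hfin : ∀ s : ℝ, volume (A ∩ closedBall 0 s) ≠ ⊤ := fun s =>
    measure_ne_top_of_subset Set.inter_subset_right measure_closedBall_lt_top.ne
  have hscale : ∀ s : ℝ, 0 < s →
      volume.real (A ∩ closedBall 0 s) = s ^ 2 * volume.real (A ∩ closedBall 0 1) := by
    intro s hs
    have h : A ∩ closedBall 0 s = s • (A ∩ closedBall 0 1) := by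
      rw [Set.smul_set_inter₀ hs.ne', smul_unitClosedBall_of_nonneg hs.le]
      congr 1
      refine Set.Subset.antisymm (fun z hz => ?_) ?_
      · exact ⟨s⁻¹ • z, hcone _ (inv_pos.2 hs) z hz, smul_inv_smul₀ hs.ne' z⟩
      · rintro _ ⟨z, hz, rfl⟩
        exact hcone s hs z hz
    rw [h, measureReal_def, Measure.addHaar_smul, finrank_euclideanSpace_fin, ENNReal.toReal_mul,
      abs_of_nonneg (by positivity), ENNReal.toReal_ofReal (by positivity), measureReal_def]
  refine ⟨volume.real (A ∩ closedBall 0 1), ?_, fun s s' hs hss' => ?_⟩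
  · refine ENNReal.toReal_pos (ne_of_gt ?_) (hfin 1)
    obtain ⟨v, hv⟩ := hne
    have hpos : 0 < ‖v‖ + 1 := by positivity
    have hmem : (‖v‖ + 1)⁻¹ • v ∈ A ∩ ball 0 1 := by
      refine ⟨hcone _ (inv_pos.2 hpos) v hv, ?_⟩
      rw [mem_ball_zero_iff, norm_smul, norm_inv, Real.norm_of_nonneg hpos.le, inv_mul_eq_div,
        div_lt_one hpos]
      linarith
    exact ((hA.inter isOpen_ball).measure_pos volume ⟨_, hmem⟩).trans_le
      (measure_mono (Set.inter_subset_inter_right _ ball_subset_closedBall))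
  · have h : (A ∩ closedBall 0 s') \ closedBall 0 s
        = (A ∩ closedBall 0 s') \ (A ∩ closedBall 0 s) := by
      ext z; simp only [Set.mem_sdiff, Set.mem_inter_iff]; tauto
    rw [h, measureReal_sdiff (Set.inter_subset_inter_right _ (closedBall_subset_closedBall hss'))
      (hA.measurableSet.inter measurableSet_closedBall) (hfin s'), hscale s hs,
      hscale s' (hs.trans_le hss')]
    ring

lemma nonneg_of_forall_ge_linear {b c T : ℝ} (h : ∀ t, T ≤ t → 0 ≤ b * t + c) : 0 ≤ b := by
  by_contra! hb
  have h1 := h (max T (|c| / (-b) + 1)) (le_max_left _ _)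
  have h2 : |c| / (-b) + 1 ≤ max T (|c| / (-b) + 1) := le_max_right _ _
  have h3 : b * max T (|c| / (-b) + 1) ≤ b * (|c| / (-b) + 1) :=
    mul_le_mul_of_nonpos_left h2 hb.le
  have h4 : b * (|c| / (-b) + 1) = -|c| + b := by
    have := hb.ne
    field_simp
  linarith [le_abs_self c]

/-- A planar compact set containing a disc and a further point has perimeter larger than that of
the disc, where the perimeter is read off from the Steiner polynomial. -/
lemma two_pi_mul_lt_of_closedBall_subset {K : Set (EuclideanSpace ℝ (Fin 2))} (hK : IsCompact K)
    {L : ℝ} (hL : ∀ t : ℝ, 0 ≤ t →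
      volume.real (K + closedBall 0 t) = volume.real K + L * t + Real.pi * t ^ 2)
    {R : ℝ} (hR : 0 ≤ R) (hsub : closedBall 0 R ⊆ K) {p : EuclideanSpace ℝ (Fin 2)}
    (hpK : p ∈ K) (hp : R < ‖p‖) : 2 * Real.pi * R < L := by
  set δ : ℝ := (‖p‖ - R) / 3 with hδ
  have hδ0 : 0 < δ := by rw [hδ]; linarith
  set c : ℝ := R + 2 * δ with hc
  have hcp : c < ‖p‖ := by rw [hc, hδ]; linarith
  obtain ⟨a, ha, hvol⟩ := exists_volume_real_sector
    (A := {z | c * ‖z‖ < inner ℝ z p})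
    (isOpen_lt (by fun_prop) (by fun_prop))
    (fun s hs z hz => by
      simp only [Set.mem_ofPred_eq, norm_smul, real_inner_smul_left, Real.norm_of_nonneg hs.le]
        at hz ⊢
      nlinarith)
    ⟨p, by
      simp only [Set.mem_ofPred_eq, real_inner_self_eq_norm_sq]
      nlinarith⟩
  set A : Set (EuclideanSpace ℝ (Fin 2)) := {z | c * ‖z‖ < inner ℝ z p}
  have key : 0 ≤ L - 2 * Real.pi * R - 2 * a * δ := by
    refine nonneg_of_forall_ge_linear
      (c := volume.real K - Real.pi * R ^ 2 - a * (2 * R * δ + δ ^ 2))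
      (T := 2 * δ + ‖p‖ ^ 2 / (2 * δ)) fun t ht => ?_
    have hq : 0 ≤ ‖p‖ ^ 2 / (2 * δ) := by positivity
    have ht2 : 2 * δ ≤ t := by linarith
    have hlarge : ‖p‖ ^ 2 ≤ 2 * δ * t - 4 * δ ^ 2 := by
      have h1 : ‖p‖ ^ 2 / (2 * δ) ≤ t - 2 * δ := by linarith
      rw [div_le_iff₀ (by positivity)] at h1
      linarith
    have ht0 : 0 < t := by linarith
    have hsubset : closedBall 0 (R + t) ∪ ((A ∩ closedBall 0 (R + t + δ)) \ closedBall 0 (R + t))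
        ⊆ K + closedBall 0 t := by
      rintro z (hz | ⟨⟨hzA, hz1⟩, hz2⟩)
      · have h := closedBall_add_closedBall hR ht0.le (0 : EuclideanSpace ℝ (Fin 2)) 0
        rw [add_zero] at h
        rw [← h] at hz
        exact Set.add_subset_add_right hsub hz
      · rw [mem_closedBall_zero_iff] at hz1 hz2
        rw [not_le] at hz2
        refine ⟨p, hpK, z - p, ?_, add_sub_cancel p z⟩
        rw [mem_closedBall_zero_iff]
        refine abs_le_of_sq_le_sq' ?_ ht0.le |>.2
        rw [norm_sub_sq_real]
        have hzA' : c * ‖z‖ < inner ℝ z p := hzA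
        have h1 : 0 ≤ ‖z‖ - c := by linarith
        have h2 : ‖z‖ - c ≤ t - δ := by linarith
        have h3 : (‖z‖ - c) ^ 2 ≤ (t - δ) ^ 2 := pow_le_pow_left₀ h1 h2 2
        nlinarith [sq_nonneg c, sq_nonneg δ]
    have hle := measureReal_mono (μ := volume) hsubset
      (hK.add (isCompact_closedBall 0 t)).measure_lt_top.ne
    rw [measureReal_union Set.disjoint_sdiff_right
      ((isOpen_lt (by fun_prop) (by fun_prop) : IsOpen A).measurableSet.inter
        measurableSet_closedBall |>.diff measurableSet_closedBall)
      measure_closedBall_lt_top.ne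
      (measure_ne_top_of_subset (Set.sdiff_subset.trans Set.inter_subset_right)
        measure_closedBall_lt_top.ne),
      hvol _ _ (by linarith) (by linarith), volume_real_closedBall_fin_two _ (by linarith),
      hL t ht0.le] at hle
    nlinarith
  have : 0 < a * δ := by positivity
  linarith

/-- A planar set contained in a disc and missing a neighbourhood of a boundary point of that disc
has perimeter smaller than that of the disc, where the perimeter is read off from the Steiner
polynomial. -/
lemma lt_two_pi_mul_of_subset_closedBall {K : Set (EuclideanSpace ℝ (Fin 2))}
    {L : ℝ} (hL : ∀ t : ℝ, 0 ≤ t →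
      volume.real (K + closedBall 0 t) = volume.real K + L * t + Real.pi * t ^ 2)
    {R : ℝ} (hR : 0 < R) (hsub : K ⊆ closedBall 0 R) (hclosed : IsClosed K)
    {q : EuclideanSpace ℝ (Fin 2)} (hqK : q ∉ K) (hq : ‖q‖ = R) : L < 2 * Real.pi * R := by
  obtain ⟨ε, hε, hball⟩ := Metric.isOpen_iff.1 hclosed.isOpen_compl q hqK
  set v : EuclideanSpace ℝ (Fin 2) := R⁻¹ • q with hv
  have hqv : q = R • v := by rw [hv, smul_inv_smul₀ hR.ne']
  have hv1 : ‖v‖ = 1 := by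
    rw [hv, norm_smul, norm_inv, Real.norm_of_nonneg hR.le, hq, inv_mul_cancel₀ hR.ne']
  clear_value v
  set δ : ℝ := ε ^ 2 / (4 * R) with hδ
  have hδ0 : 0 < δ := by positivity
  have hδR : 4 * R * δ = ε ^ 2 := by rw [hδ]; field_simp
  set η : ℝ := δ / R with hη
  have hη0 : 0 < η := by positivity
  have hηR : R * η = δ := by rw [hη]; field_simp
  have hsupp : ∀ y ∈ K, inner ℝ y v ≤ R - 2 * δ := by
    intro y hy
    have h1 : ‖y‖ ≤ R := mem_closedBall_zero_iff.1 (hsub hy)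
    have h2 : ε ≤ ‖y - q‖ := by
      by_contra! h
      exact hball (mem_ball_iff_norm.2 h) hy
    have h3 : ε ^ 2 ≤ ‖y - q‖ ^ 2 := pow_le_pow_left₀ hε.le h2 2
    have h4 : ‖y‖ ^ 2 ≤ R ^ 2 := pow_le_pow_left₀ (norm_nonneg y) h1 2
    rw [norm_sub_sq_real, hq, hqv, real_inner_smul_right] at h3
    refine le_of_mul_le_mul_left ?_ hR
    linarith
  have hopen : IsOpen {z : EuclideanSpace ℝ (Fin 2) | ‖z - ‖z‖ • v‖ < η * ‖z‖} :=
    isOpen_lt (by fun_prop) (by fun_prop)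
  obtain ⟨a, ha, hvol⟩ := exists_volume_real_sector hopen
    (fun s hs z hz => by
      have h : s • z - ‖s • z‖ • v = s • (z - ‖z‖ • v) := by
        rw [norm_smul, Real.norm_of_nonneg hs.le, smul_sub, smul_smul]
      simp only [Set.mem_ofPred_eq] at hz ⊢
      rw [h, norm_smul, norm_smul, Real.norm_of_nonneg hs.le]
      nlinarith)
    ⟨v, by simp [hv1, hη0]⟩
  set A : Set (EuclideanSpace ℝ (Fin 2)) := {z | ‖z - ‖z‖ • v‖ < η * ‖z‖}
  have key : 0 ≤ 2 * Real.pi * R - L - 2 * a * δ := by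
    refine nonneg_of_forall_ge_linear
      (c := Real.pi * R ^ 2 - volume.real K - a * (2 * R * δ - δ ^ 2))
      (T := δ) fun t ht => ?_
    have ht0 : 0 < t := by linarith
    have hsubset : (K + closedBall 0 t) ⊆
        closedBall 0 (R + t) \ ((A ∩ closedBall 0 (R + t)) \ closedBall 0 (R + t - δ)) := by
      rintro _ ⟨y, hy, w, hw, rfl⟩
      have hyR : ‖y‖ ≤ R := mem_closedBall_zero_iff.1 (hsub hy)
      have hwt : ‖w‖ ≤ t := mem_closedBall_zero_iff.1 hw
      set z := y + w with hz
      refine ⟨mem_closedBall_zero_iff.2 ((norm_add_le _ _).trans (by linarith)), ?_⟩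
      rintro ⟨⟨hzA, -⟩, hz2⟩
      rw [mem_closedBall_zero_iff, not_le] at hz2
      have hzA' : ‖z - ‖z‖ • v‖ < η * ‖z‖ := hzA
      have hz0 : 0 < ‖z‖ := by linarith
      have h1 : inner ℝ y z = ‖z‖ * inner ℝ y v + inner ℝ y (z - ‖z‖ • v) := by
        rw [inner_sub_right, real_inner_smul_right]; ring
      have h2 : inner ℝ y (z - ‖z‖ • v) ≤ R * (η * ‖z‖) :=
        (real_inner_le_norm _ _).trans
          (mul_le_mul hyR hzA'.le (norm_nonneg _) hR.le)
      have h3 : inner ℝ w z ≤ t * ‖z‖ :=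
        (real_inner_le_norm _ _).trans (mul_le_mul_of_nonneg_right hwt hz0.le)
      have h4 : ‖z‖ ^ 2 = inner ℝ y z + inner ℝ w z := by
        rw [← inner_add_left, ← hz, real_inner_self_eq_norm_sq]
      have h5 : ‖z‖ * inner ℝ y v ≤ ‖z‖ * (R - 2 * δ) :=
        mul_le_mul_of_nonneg_left (hsupp y hy) hz0.le
      have h6 : R * (η * ‖z‖) = δ * ‖z‖ := by rw [← mul_assoc, hηR]
      nlinarith
    have hle := measureReal_mono (μ := volume) hsubset
      (measure_ne_top_of_subset Set.sdiff_subset measure_closedBall_lt_top.ne)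
    rw [measureReal_sdiff (Set.sdiff_subset.trans Set.inter_subset_right)
      ((hopen.measurableSet.inter measurableSet_closedBall).diff measurableSet_closedBall)
      measure_closedBall_lt_top.ne,
      hvol _ _ (by linarith) (by linarith), volume_real_closedBall_fin_two _ (by linarith),
      hL t ht0.le] at hle
    nlinarith
  have : 0 < a * δ := by positivity
  linarith

lemma closedBall_subset_iff_forall_add_smul_mem {E : Type*} [NormedAddCommGroup E]
    [NormedSpace ℝ E] {K : Set E} {x : E} {r : ℝ} (hr : 0 ≤ r) :
    closedBall x r ⊆ K ↔ ∀ w ∈ closedBall (0 : E) 1, x + r • w ∈ K := by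
  rw [← affinity_unitClosedBall hr x]
  simp only [Set.subset_def, Set.mem_vadd_set, Set.mem_smul_set, vadd_eq_add]
  aesop

/-- A compact set contains a disc of maximal radius. -/
lemma exists_isGreatest_inradius {E : Type*} [NormedAddCommGroup E] [NormedSpace ℝ E]
    [Nontrivial E] {K : Set E} (hK : IsCompact K) (hne : K.Nonempty) :
    ∃ R, IsGreatest {r : ℝ | 0 ≤ r ∧ ∃ x, closedBall x r ⊆ K} R := by
  obtain ⟨x₀, hx₀⟩ := hne
  obtain ⟨M, hM⟩ := hK.isBounded.subset_closedBall x₀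
  have hbound : ∀ x r, 0 ≤ r → closedBall x r ⊆ K → r ≤ M := by
    intro x r hr h
    have h1 := Metric.diam_mono (h.trans hM) isBounded_closedBall
    have hM0 : 0 ≤ M := dist_nonneg.trans (mem_closedBall.1 (hM hx₀))
    rw [diam_closedBall_eq x hr, diam_closedBall_eq x₀ hM0] at h1
    linarith
  have hclosed : IsClosed {q : E × ℝ | ∀ w ∈ closedBall (0 : E) 1, q.1 + q.2 • w ∈ K} := by
    simp only [Set.ofPred_forall]
    exact isClosed_biInter fun w _ => hK.isClosed.preimage (by fun_prop)
  have hcomp := ((hK.prod (isCompact_Icc (a := (0 : ℝ)) (b := M))).inter_right hclosed).image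
    continuous_snd
  have heq : {r : ℝ | 0 ≤ r ∧ ∃ x, closedBall x r ⊆ K} =
      Prod.snd '' ((K ×ˢ Set.Icc (0 : ℝ) M) ∩
        {q : E × ℝ | ∀ w ∈ closedBall (0 : E) 1, q.1 + q.2 • w ∈ K}) := by
    ext r
    constructor
    · rintro ⟨hr, x, hx⟩
      exact ⟨(x, r), ⟨⟨hx (mem_closedBall_self hr), hr, hbound x r hr hx⟩,
        (closedBall_subset_iff_forall_add_smul_mem hr).1 hx⟩, rfl⟩
    · rintro ⟨⟨x, r⟩, ⟨⟨-, hr, -⟩, hx⟩, rfl⟩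
      exact ⟨hr, x, (closedBall_subset_iff_forall_add_smul_mem hr).2 hx⟩
  rw [heq]
  refine hcomp.exists_isGreatest ?_
  rw [← heq]
  exact ⟨0, le_rfl, x₀, by simpa using hx₀⟩

/-- A nonempty bounded set in a proper space lies in a disc of minimal radius. -/
lemma exists_isLeast_circumradius {X : Type*} [MetricSpace X] [ProperSpace X] {K : Set X}
    (hK : Bornology.IsBounded K) (hne : K.Nonempty) :
    ∃ R, IsLeast {r : ℝ | 0 ≤ r ∧ ∃ x, K ⊆ closedBall x r} R := by
  obtain ⟨x₀, hx₀⟩ := hne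
  obtain ⟨M, hM⟩ := hK.subset_closedBall x₀
  have hM0 : 0 ≤ M := dist_nonneg.trans (mem_closedBall.1 (hM hx₀))
  have hclosed : IsClosed {q : X × ℝ | ∀ y ∈ K, dist y q.1 ≤ q.2} := by
    simp only [Set.ofPred_forall]
    exact isClosed_biInter fun w _ => isClosed_le (by fun_prop) (by fun_prop)
  have hcomp := (((isCompact_closedBall x₀ M).prod
    (isCompact_Icc (a := (0 : ℝ)) (b := M))).inter_right hclosed).image continuous_snd
  obtain ⟨R, ⟨⟨x, r⟩, ⟨⟨-, hr, hrM⟩, hx⟩, rfl⟩, hmin⟩ := hcomp.exists_isLeast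
    ⟨M, (x₀, M), ⟨⟨mem_closedBall_self hM0, hM0, le_rfl⟩, fun y hy => hM hy⟩, rfl⟩
  refine ⟨r, ⟨hr, x, fun y hy => hx y hy⟩, ?_⟩
  rintro s ⟨hs, y, hy⟩
  rcases le_total s M with hsM | hsM
  · refine hmin ⟨(y, s), ⟨⟨?_, hs, hsM⟩, fun z hz => hy hz⟩, rfl⟩
    rw [mem_closedBall']
    exact (mem_closedBall.1 (hy hx₀)).trans hsM
  · exact le_trans hrM hsM

/-- For a planar convex body `K` with nonempty interior which is not a disc, the
perimeter `L` satisfies `2π R_i < L < 2π R_e`, where `R_i` is the inradius and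
`R_e` the circumradius of `K`. -/
theorem planar_perimeter_between_radii (K : Set (EuclideanSpace ℝ (Fin 2)))
    (hKne : K.Nonempty) (hKcomp : IsCompact K) (hKconv : Convex ℝ K)
    (hKint : (interior K).Nonempty)
    (hKnotdisc : ¬ ∃ (x : EuclideanSpace ℝ (Fin 2)) (r : ℝ), K = closedBall x r)
    (L : ℝ)
    (hL : ∀ t : ℝ, 0 ≤ t →
      (volume (K + t • closedBall (0 : EuclideanSpace ℝ (Fin 2)) 1)).toReal
        = (volume K).toReal + L * t + Real.pi * t ^ 2)
    (Ri Re : ℝ)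
    (hRi : Ri = sSup {r : ℝ | 0 ≤ r ∧ ∃ x : EuclideanSpace ℝ (Fin 2), closedBall x r ⊆ K})
    (hRe : Re = sInf {r : ℝ | 0 ≤ r ∧ ∃ x : EuclideanSpace ℝ (Fin 2), K ⊆ closedBall x r}) :
    2 * Real.pi * Ri < L ∧ L < 2 * Real.pi * Re := by
  have hvol : ∀ x : EuclideanSpace ℝ (Fin 2), ∀ t : ℝ, 0 ≤ t →
      volume.real ((-x +ᵥ K) + closedBall 0 t)
        = volume.real (-x +ᵥ K) + L * t + Real.pi * t ^ 2 := by
    intro x t ht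
    have h := hL t ht
    rw [smul_unitClosedBall_of_nonneg ht] at h
    rw [vadd_add_assoc, measureReal_def, measureReal_def, measure_vadd, measure_vadd, h]
  constructor
  · obtain ⟨R, hR⟩ := exists_isGreatest_inradius hKcomp hKne
    rw [hRi, hR.csSup_eq]
    obtain ⟨hR0, x, hx⟩ := hR.1
    obtain ⟨p, hpK, hp⟩ : ∃ p ∈ K, p ∉ closedBall x R := by
      by_contra! h
      exact hKnotdisc ⟨x, R, Set.Subset.antisymm h hx⟩
    refine two_pi_mul_lt_of_closedBall_subset (hKcomp.vadd (-x)) (hvol x) hR0 (p := -x +ᵥ p) ?_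
      (Set.vadd_mem_vadd_set hpK) ?_
    · have h := Set.vadd_set_mono (a := -x) hx
      rwa [vadd_closedBall, vadd_eq_add, neg_add_cancel] at h
    · rwa [mem_closedBall_iff_norm, not_le, sub_eq_neg_add] at hp
  · obtain ⟨R, hR⟩ := exists_isLeast_circumradius hKcomp.isBounded hKne
    rw [hRe, hR.csInf_eq]
    obtain ⟨hR0, x, hx⟩ := hR.1
    obtain ⟨q, hq, hqK⟩ : ∃ q ∈ sphere x R, q ∉ K := by
      by_contra! h
      refine hKnotdisc ⟨x, R, Set.Subset.antisymm hx ?_⟩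
      rw [← convexHull_sphere_eq_closedBall x hR0]
      exact convexHull_min h hKconv
    have hRpos : 0 < R := by
      refine hR0.lt_of_ne' ?_
      rintro rfl
      rw [closedBall_zero] at hx
      have h := hKint.mono (interior_mono hx)
      rw [interior_singleton] at h
      exact Set.not_nonempty_empty h
    refine lt_two_pi_mul_of_subset_closedBall (hvol x) hRpos ?_ (hKcomp.vadd (-x)).isClosed
      (q := -x +ᵥ q) ?_ ?_
    · have h := Set.vadd_set_mono (a := -x) hx
      rwa [vadd_closedBall, vadd_eq_add, neg_add_cancel] at h
    · rwa [Set.vadd_mem_vadd_set_iff]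
    · rwa [mem_sphere_iff_norm, sub_eq_neg_add] at hq
end
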